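/- arXiv:2302.06434 — 6 statements merged into one kernel-verified Lean document; each statement's English description precedes it below -/
import Mathlib

section
/- Let L be a real symmetric p×p matrix with L·1 = 0. Then rank(L + J) = rank(L) + 1. -/
open Matrix BigOperators

/-- The `p × p` matrix all of whose entries are `1/p`. -/
noncomputable def matJ (p : ℕ) : Matrix (Fin p) (Fin p) ℝ :=
  Matrix.of fun _ _ => (1 : ℝ) / p

theorem matJ_mulVec (p : ℕ) (x : Fin p → ℝ) :
    matJ p *ᵥ x = ((∑ j, x j) / p) • (1 : Fin p → ℝ) := by
  ext i
  simp only [matJ, mulVec, dotProduct, of_apply, Pi.smul_apply, Pi.one_apply, smul_eq_mul, mul_one]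
  rw [← Finset.mul_sum]
  ring

theorem sum_mulVec_eq_zero {n R : Type*} [Fintype n] [CommSemiring R] {L : Matrix n n R}
    (hL : 1 ᵥ* L = 0) (x : n → R) : ∑ i, (L *ᵥ x) i = 0 := by
  rw [← one_dotProduct, dotProduct_mulVec, hL, zero_dotProduct]

theorem range_mulVecLin_add_matJ {p : ℕ} (hp : p ≠ 0) {L : Matrix (Fin p) (Fin p) ℝ}
    (hL : L *ᵥ 1 = 0) :
    LinearMap.range (L + matJ p).mulVecLin = LinearMap.range L.mulVecLin ⊔ ℝ ∙ (1 : Fin p → ℝ) := by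
  have hp' : (p : ℝ) ≠ 0 := Nat.cast_ne_zero.mpr hp
  have h1 : (L + matJ p) *ᵥ 1 = 1 := by
    rw [add_mulVec, hL, matJ_mulVec]
    simp [hp']
  apply le_antisymm
  · rintro _ ⟨x, rfl⟩
    rw [mulVecLin_apply, add_mulVec, matJ_mulVec]
    exact Submodule.add_mem_sup ⟨x, rfl⟩ (Submodule.smul_mem _ _ (Submodule.mem_span_singleton_self _))
  · refine sup_le ?_ ?_
    · rintro _ ⟨x, rfl⟩
      refine ⟨x - ((∑ j, x j) / p) • 1, ?_⟩
      rw [map_sub, map_smul, mulVecLin_apply, mulVecLin_apply, h1, add_mulVec, matJ_mulVec,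
        add_sub_cancel_right, mulVecLin_apply]
    · rw [Submodule.span_singleton_le_iff_mem]
      exact ⟨1, h1⟩

theorem disjoint_range_mulVecLin_span_one {p : ℕ} (hp : p ≠ 0) {L : Matrix (Fin p) (Fin p) ℝ}
    (hL : 1 ᵥ* L = 0) :
    Disjoint (LinearMap.range L.mulVecLin) (ℝ ∙ (1 : Fin p → ℝ)) := by
  rw [Submodule.disjoint_def]
  rintro _ ⟨x, rfl⟩ hx
  obtain ⟨c, hc⟩ := Submodule.mem_span_singleton.mp hx
  have hsum := sum_mulVec_eq_zero hL x
  rw [← mulVecLin_apply, ← hc] at hsum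
  have hc0 : c = 0 := by simpa [hp] using hsum
  rw [← hc, hc0, zero_smul]

/-- if `L` is a real symmetric `p × p` matrix with `L·1 = 0`, then
`rank (L + J) = rank L + 1`. -/
theorem rank_add_J (p : ℕ) (hp : 1 ≤ p) (L : Matrix (Fin p) (Fin p) ℝ)
    (hsymm : L.IsSymm) (hrow : ∀ i, ∑ j, L i j = 0) :
    (L + matJ p).rank = L.rank + 1 := by
  have hp0 : p ≠ 0 := Nat.one_le_iff_ne_zero.mp hp
  have : NeZero p := ⟨hp0⟩
  have hr : L *ᵥ 1 = 0 := by
    ext i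
    simpa [mulVec, dotProduct] using hrow i
  have hl : 1 ᵥ* L = 0 := by
    rw [← mulVec_transpose, hsymm.eq, hr]
  have h := Submodule.finrank_sup_add_finrank_inf_eq
    (LinearMap.range L.mulVecLin) (ℝ ∙ (1 : Fin p → ℝ))
  rwa [(disjoint_range_mulVecLin_span_one hp0 hl).eq_bot, finrank_bot, add_zero,
    ← range_mulVecLin_add_matJ hp0 hr, finrank_span_singleton one_ne_zero] at h
end

section
/- (Theorem 1) Let S be a real symmetric p×p matrix and let ρ : ℝ^{p×p} → ℝ be an arbitrary penalty function. A matrix L̂ minimizes the objective Tr(L S) − log det(L + J) + ρ(L) over the set { L ∈ F : det(L + J) ≠ 0 } if and only if L̂ belongs to the set L of connected-graph Laplacians and minimizes Tr(L S) − log pdet(L) + ρ(L) over L, where pdet(L) denotes the product of the nonzero eigenvalues of L. -/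
open Matrix BigOperators

/-- The set `F` of real symmetric `p × p` matrices with nonpositive off-diagonal
entries and zero row sums. -/
def setF (p : ℕ) : Set (Matrix (Fin p) (Fin p) ℝ) :=
  {L | L.IsSymm ∧ (∀ i j, i ≠ j → L i j ≤ 0) ∧ ∀ i, ∑ j, L i j = 0}

/-- The set `𝓛` of connected-graph Laplacians. -/
def setL (p : ℕ) : Set (Matrix (Fin p) (Fin p) ℝ) :=
  {L | L.PosSemidef ∧ (∀ i j, i ≠ j → L i j ≤ 0) ∧ (∀ i, ∑ j, L i j = 0) ∧
    L.rank = p - 1}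

open Classical in
/-- The pseudo-determinant of a Hermitian real matrix: the product of its nonzero
eigenvalues (junk value `0` off the Hermitian matrices). -/
noncomputable def pdet {p : ℕ} (A : Matrix (Fin p) (Fin p) ℝ) : ℝ :=
  if h : A.IsHermitian then
    ∏ i ∈ Finset.univ.filter (fun i => h.eigenvalues i ≠ 0), h.eigenvalues i
  else 0

open Polynomial in
theorem charpoly_mul_charpoly_of_mul_eq_zero {n R : Type*} [Fintype n] [DecidableEq n]
    [CommRing R] {A B : Matrix n n R} (h : A * B = 0) :
    A.charpoly * B.charpoly = X ^ Fintype.card n * (A + B).charpoly := by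
  have hC : A.map (C : R → R[X]) * B.map C = 0 := by
    rw [← Matrix.map_mul, h, Matrix.map_zero _ C_0]
  have hmul : A.charmatrix * B.charmatrix = (X : R[X]) • (A + B).charmatrix := by
    simp only [charmatrix, RingHom.mapMatrix_apply, scalar_apply, ← smul_one_eq_diagonal,
      Matrix.map_add _ (fun a b => C_add (a := a) (b := b)), sub_mul, mul_sub, hC]
    simp only [Matrix.smul_mul, Matrix.mul_smul, Matrix.one_mul, Matrix.mul_one, smul_sub, smul_add]
    abel
  rw [charpoly, charpoly, ← det_mul, hmul, det_smul, charpoly]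

theorem matJ_eq_vecMulVec (p : ℕ) :
    matJ p = vecMulVec (fun _ => (1 : ℝ)) (fun _ => (1 : ℝ) / p) := by
  ext i j
  simp [matJ, vecMulVec_apply]

theorem mul_matJ_eq_zero {p : ℕ} {L : Matrix (Fin p) (Fin p) ℝ}
    (h : ∀ i, ∑ j, L i j = 0) : L * matJ p = 0 := by
  ext i j
  simp [matJ, mul_apply, ← Finset.sum_mul, h i]

open Polynomial in
theorem charpoly_matJ {p : ℕ} (hp : p ≠ 0) :
    (matJ p).charpoly = X ^ (p - 1) * (X - 1) := by
  obtain ⟨q, rfl⟩ := Nat.exists_eq_succ_of_ne_zero hp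
  have hdot : (fun _ : Fin (q + 1) => (1 : ℝ)) ⬝ᵥ (fun _ => (1 : ℝ) / (q + 1 : ℕ)) = 1 := by
    simp only [dotProduct, one_mul, Finset.sum_const, Finset.card_univ, Fintype.card_fin,
      nsmul_eq_mul]
    field_simp
  rw [matJ_eq_vecMulVec, charpoly_vecMulVec, hdot]
  simp [pow_succ, mul_sub]

open Polynomial in
theorem X_mul_charpoly_add_matJ {p : ℕ} (hp : p ≠ 0) {L : Matrix (Fin p) (Fin p) ℝ}
    (h : ∀ i, ∑ j, L i j = 0) :
    X * (L + matJ p).charpoly = (X - 1) * L.charpoly := by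
  have key := charpoly_mul_charpoly_of_mul_eq_zero (mul_matJ_eq_zero h)
  rw [charpoly_matJ hp, Fintype.card_fin] at key
  obtain ⟨q, rfl⟩ := Nat.exists_eq_succ_of_ne_zero hp
  apply mul_left_cancel₀ (pow_ne_zero q (X_ne_zero (R := ℝ)))
  simp only [Nat.succ_eq_add_one, Nat.add_sub_cancel, pow_succ] at key
  linear_combination -key

theorem exists_eigenvalue_eq_zero {p : ℕ} (hp : p ≠ 0) {L : Matrix (Fin p) (Fin p) ℝ}
    (hL : L.IsHermitian) (h : ∀ i, ∑ j, L i j = 0) : ∃ k, hL.eigenvalues k = 0 := by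
  have : NeZero p := ⟨hp⟩
  have hdet : L.det = 0 := by
    rw [← exists_mulVec_eq_zero_iff]
    refine ⟨fun _ => 1, fun h0 => one_ne_zero (congrFun h0 0), ?_⟩
    ext i
    simp [mulVec, dotProduct, h i]
  rw [hL.det_eq_prod_eigenvalues, Finset.prod_eq_zero_iff] at hdet
  obtain ⟨k, -, hk⟩ := hdet
  exact ⟨k, by simpa using hk⟩

open Polynomial in
theorem det_add_matJ_eq_prod_erase {p : ℕ} (hp : p ≠ 0) {L : Matrix (Fin p) (Fin p) ℝ}
    (hL : L.IsHermitian) (h : ∀ i, ∑ j, L i j = 0) {k : Fin p} (hk : hL.eigenvalues k = 0) :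
    (L + matJ p).det = ∏ i ∈ Finset.univ.erase k, hL.eigenvalues i := by
  have key := X_mul_charpoly_add_matJ hp h
  rw [hL.charpoly_eq, ← Finset.mul_prod_erase _ _ (Finset.mem_univ k), hk, RCLike.ofReal_zero,
    C_0, sub_zero, mul_left_comm] at key
  have hchar := mul_left_cancel₀ X_ne_zero key
  obtain ⟨q, rfl⟩ := Nat.exists_eq_succ_of_ne_zero hp
  rw [det_eq_sign_charpoly_coeff, hchar, coeff_zero_eq_eval_zero, eval_mul, eval_prod]
  simp only [eval_sub, eval_X, eval_one, eval_C, zero_sub, Finset.prod_neg,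
    Finset.card_erase_of_mem (Finset.mem_univ k), Finset.card_univ, Fintype.card_fin,
    Nat.succ_eq_add_one, Nat.add_sub_cancel, RCLike.ofReal_real_eq_id, id]
  rw [pow_succ]
  have hsq : ((-1 : ℝ) ^ q) * (-1) ^ q = 1 := by rw [← mul_pow]; simp
  linear_combination (∏ i ∈ Finset.univ.erase k, hL.eigenvalues i) * hsq

theorem det_add_matJ_ne_zero_iff {p : ℕ} (hp : p ≠ 0) {L : Matrix (Fin p) (Fin p) ℝ}
    (hL : L.IsHermitian) (h : ∀ i, ∑ j, L i j = 0) :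
    (L + matJ p).det ≠ 0 ↔ L.rank = p - 1 := by
  obtain ⟨k, hk⟩ := exists_eigenvalue_eq_zero hp hL h
  have hsub : Finset.univ.filter (fun i => hL.eigenvalues i ≠ 0) ⊆ Finset.univ.erase k := by
    intro i hi
    simp only [Finset.mem_filter, Finset.mem_univ, true_and, Finset.mem_erase, and_true] at hi ⊢
    rintro rfl
    exact hi hk
  have hcard : (Finset.univ.erase k).card = p - 1 := by simp
  rw [det_add_matJ_eq_prod_erase hp hL h hk, hL.rank_eq_card_non_zero_eigs, Fintype.card_subtype,
    Finset.prod_ne_zero_iff]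
  constructor
  · intro hne
    rw [← hcard, hsub.antisymm fun i hi => Finset.mem_filter.2 ⟨Finset.mem_univ i, hne i hi⟩]
  · intro hr i hi
    rw [← Finset.eq_of_subset_of_card_le hsub (by rw [hcard, hr])] at hi
    exact (Finset.mem_filter.1 hi).2

theorem pdet_eq_det_add_matJ {p : ℕ} (hp : p ≠ 0) {L : Matrix (Fin p) (Fin p) ℝ}
    (hL : L.IsHermitian) (h : ∀ i, ∑ j, L i j = 0) (hdet : (L + matJ p).det ≠ 0) :
    pdet L = (L + matJ p).det := by
  obtain ⟨k, hk⟩ := exists_eigenvalue_eq_zero hp hL h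
  rw [det_add_matJ_eq_prod_erase hp hL h hk] at hdet ⊢
  rw [Finset.prod_ne_zero_iff] at hdet
  rw [pdet, dif_pos hL]
  refine Finset.prod_congr ?_ fun _ _ => rfl
  ext i
  simp only [Finset.mem_filter, Finset.mem_univ, true_and, Finset.mem_erase, and_true]
  refine ⟨?_, fun hi => hdet i (by simpa using hi)⟩
  rintro hi rfl
  exact hi hk

theorem posSemidef_of_mem_setF {p : ℕ} {L : Matrix (Fin p) (Fin p) ℝ} (hL : L ∈ setF p) :
    L.PosSemidef := by
  obtain ⟨hsymm, hoff, hrow⟩ := hL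
  refine .of_dotProduct_mulVec_nonneg (by simpa [IsHermitian, IsSymm] using hsymm) fun x => ?_
  have hcol : ∀ j, ∑ i, L i j = 0 := fun j => by
    rw [← hrow j]
    exact Finset.sum_congr rfl fun i _ => hsymm.apply j i
  have hquad : star x ⬝ᵥ (L *ᵥ x) = ∑ i, ∑ j, L i j * (x i * x j) := by
    simp only [dotProduct, mulVec, Finset.mul_sum, Pi.star_apply, star_trivial]
    exact Finset.sum_congr rfl fun i _ => Finset.sum_congr rfl fun j _ => by ring
  have hdiff : ∑ i, ∑ j, L i j * (x i - x j) ^ 2 = -2 * ∑ i, ∑ j, L i j * (x i * x j) := by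
    have h1 : ∑ i, ∑ j, L i j * x i ^ 2 = 0 := by
      simp [← Finset.sum_mul, hrow]
    have h2 : ∑ i, ∑ j, L i j * x j ^ 2 = 0 := by
      rw [Finset.sum_comm]
      simp [← Finset.sum_mul, hcol]
    have hsplit : ∑ i, ∑ j, L i j * (x i - x j) ^ 2 = ∑ i, ∑ j, L i j * x i ^ 2 +
        ∑ i, ∑ j, L i j * x j ^ 2 + -2 * ∑ i, ∑ j, L i j * (x i * x j) := by
      simp only [Finset.mul_sum, ← Finset.sum_add_distrib]
      exact Finset.sum_congr rfl fun i _ => Finset.sum_congr rfl fun j _ => by ring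
    rw [hsplit, h1, h2]
    ring
  have hnonpos : ∑ i, ∑ j, L i j * (x i - x j) ^ 2 ≤ 0 := by
    refine Finset.sum_nonpos fun i _ => Finset.sum_nonpos fun j _ => ?_
    rcases eq_or_ne i j with rfl | hij
    · simp
    · exact mul_nonpos_of_nonpos_of_nonneg (hoff i j hij) (sq_nonneg _)
  rw [hquad]
  linarith

theorem mem_setL_iff {p : ℕ} (hp : p ≠ 0) {L : Matrix (Fin p) (Fin p) ℝ} :
    L ∈ setL p ↔ L ∈ setF p ∧ (L + matJ p).det ≠ 0 := by
  constructor
  · rintro ⟨hpsd, hoff, hrow, hrank⟩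
    exact ⟨⟨by simpa [IsHermitian, IsSymm] using hpsd.isHermitian, hoff, hrow⟩,
      (det_add_matJ_ne_zero_iff hp hpsd.isHermitian hrow).2 hrank⟩
  · rintro ⟨hF, hdet⟩
    have hpsd := posSemidef_of_mem_setF hF
    exact ⟨hpsd, hF.2.1, hF.2.2, (det_add_matJ_ne_zero_iff hp hpsd.isHermitian hF.2.2).1 hdet⟩

theorem pdet_eq_det_add_matJ_of_mem_setL {p : ℕ} (hp : p ≠ 0) {L : Matrix (Fin p) (Fin p) ℝ}
    (hL : L ∈ setL p) : pdet L = (L + matJ p).det :=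
  pdet_eq_det_add_matJ hp hL.1.isHermitian hL.2.2.1 ((mem_setL_iff hp).1 hL).2

/-- Theorem 1: `L̂` minimizes `Tr(L S) − log det (L + J) + ρ(L)` over
`{ L ∈ F : det (L + J) ≠ 0 }` iff `L̂ ∈ 𝓛` and it minimizes
`Tr(L S) − log pdet(L) + ρ(L)` over `𝓛`. -/
theorem minimizer_equivalence (p : ℕ) (hp : 2 ≤ p) (S : Matrix (Fin p) (Fin p) ℝ)
    (hS : S.IsSymm) (ρ : Matrix (Fin p) (Fin p) ℝ → ℝ)
    (Lhat : Matrix (Fin p) (Fin p) ℝ) :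
    (Lhat ∈ setF p ∧ (Lhat + matJ p).det ≠ 0 ∧
        ∀ L ∈ setF p, (L + matJ p).det ≠ 0 →
          (Lhat * S).trace - Real.log (Lhat + matJ p).det + ρ Lhat ≤
            (L * S).trace - Real.log (L + matJ p).det + ρ L) ↔
      (Lhat ∈ setL p ∧
        ∀ L ∈ setL p,
          (Lhat * S).trace - Real.log (pdet Lhat) + ρ Lhat ≤
            (L * S).trace - Real.log (pdet L) + ρ L) := by
  have hp0 : p ≠ 0 := by omega
  rw [← and_assoc, ← mem_setL_iff hp0]
  refine and_congr_right fun hLhat => forall_congr' fun L => ?_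
  rw [← and_imp, ← mem_setL_iff hp0]
  refine imp_congr_right fun hL => ?_
  rw [pdet_eq_det_add_matJ_of_mem_setL hp0 hLhat, pdet_eq_det_add_matJ_of_mem_setL hp0 hL]
end

section
/- Let γ > 0 and λ ≥ 0, and define g(x) = −λ − x/γ for −γλ ≤ x ≤ 0 and g(x) = 0 for x < −γλ. Then for all real numbers x ≤ 0 and y ≤ 0: MCP(x;γ,λ) + g(x)(y − x) − (y − x)²/(2γ) ≤ MCP(y;γ,λ) ≤ MCP(x;γ,λ) + g(x)(y − x). That is, on the nonpositive half-line the MCP is concave with curvature bounded below by −1/γ, admitting the quadratic expansion MCP(x+y) = MCP(x) + MCP'(x)·y − (ωy)²/(2γ) with 0 ≤ ω ≤ 1. -/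
open BigOperators

/-- The scalar minimax concave penalty `MCP(x; γ, λ)`. -/
noncomputable def MCP (γ lam x : ℝ) : ℝ :=
  if |x| ≤ γ * lam then lam * |x| - x ^ 2 / (2 * γ) else γ * lam ^ 2 / 2

/-- On the nonpositive half-line the MCP is a constant minus a squared positive part. -/
lemma MCP_eq_of_nonpos {γ lam x : ℝ} (hγ : 0 < γ) (hx : x ≤ 0) :
    MCP γ lam x = γ * lam ^ 2 / 2 - max (x + γ * lam) 0 ^ 2 / (2 * γ) := by
  unfold MCP
  rw [abs_of_nonpos hx]
  split_ifs with h
  · rw [max_eq_left (by linarith)]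
    field_simp
    ring
  · rw [max_eq_right (by linarith)]
    simp

lemma MCP_slope_eq {γ lam x : ℝ} (hγ : 0 < γ) :
    (if -(γ * lam) ≤ x then -lam - x / γ else 0) = -(max (x + γ * lam) 0 / γ) := by
  split_ifs with h
  · rw [max_eq_left (by linarith)]
    field_simp
    ring
  · rw [max_eq_right (by linarith)]
    simp

lemma max_zero_sq_le (s t : ℝ) : max t 0 ^ 2 ≤ (max s 0 + (t - s)) ^ 2 := by
  rcases le_total t 0 with ht | ht
  · rw [max_eq_right ht]
    nlinarith [sq_nonneg (max s 0 + (t - s))]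
  · rw [max_eq_left ht]
    exact pow_le_pow_left₀ ht (by linarith [le_max_left s 0]) 2

lemma max_zero_sq_tangent_le (s t : ℝ) :
    max s 0 ^ 2 + 2 * max s 0 * (t - s) ≤ max t 0 ^ 2 := by
  rcases le_total s 0 with hs | hs
  · rw [max_eq_right hs]
    nlinarith [sq_nonneg (max t 0)]
  · rw [max_eq_left hs]
    nlinarith [sq_nonneg (max t 0 - s), mul_le_mul_of_nonneg_left (le_max_left t 0) hs]

/-- on the nonpositive half-line, with
`g(x) = −λ − x/γ` for `−γλ ≤ x ≤ 0` and `g(x) = 0` for `x < −γλ`, the MCP satisfies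
`MCP(x) + g(x)(y−x) − (y−x)²/(2γ) ≤ MCP(y) ≤ MCP(x) + g(x)(y−x)` for all `x, y ≤ 0`:
it is concave with curvature bounded below by `−1/γ`. -/
theorem MCP_quadratic_bounds (γ lam : ℝ) (hγ : 0 < γ) (hlam : 0 ≤ lam)
    (x y : ℝ) (hx : x ≤ 0) (hy : y ≤ 0) :
    MCP γ lam x + (if -(γ * lam) ≤ x then -lam - x / γ else 0) * (y - x) -
        (y - x) ^ 2 / (2 * γ) ≤ MCP γ lam y ∧
      MCP γ lam y ≤
        MCP γ lam x + (if -(γ * lam) ≤ x then -lam - x / γ else 0) * (y - x) := by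
  rw [MCP_eq_of_nonpos hγ hx, MCP_eq_of_nonpos hγ hy, MCP_slope_eq hγ]
  have lower := div_le_div_of_nonneg_right
    (max_zero_sq_le (x + γ * lam) (y + γ * lam)) (by positivity : 0 ≤ 2 * γ)
  have upper := div_le_div_of_nonneg_right
    (max_zero_sq_tangent_le (x + γ * lam) (y + γ * lam)) (by positivity : 0 ≤ 2 * γ)
  generalize max (x + γ * lam) 0 = p at *
  generalize max (y + γ * lam) 0 = q at *
  rw [add_sub_add_right_eq_sub] at lower upper
  have expand_sq : (p + (y - x)) ^ 2 / (2 * γ) =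
      p ^ 2 / (2 * γ) + p / γ * (y - x) + (y - x) ^ 2 / (2 * γ) := by
    field_simp
    ring
  have expand_tangent : (p ^ 2 + 2 * p * (y - x)) / (2 * γ) =
      p ^ 2 / (2 * γ) + p / γ * (y - x) := by
    field_simp
  constructor <;> linarith
end

section
/- Let γ > 0, λ ≥ 0, and let x and d be real numbers with x ≤ 0 and x + d ≤ 0. Then for every α ∈ (0,1): −(α/(1−α))·(MCP(x+d;γ,λ) − MCP(x+αd;γ,λ)) + MCP(x+αd;γ,λ) − MCP(x;γ,λ) ≤ α d² / (2γ). -/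
open BigOperators

/-- On the negative half-line, `MCP γ lam x + x ^ 2 / (2 * γ)` has a supporting line at every
point. -/
theorem MCP_add_sq_exists_subgradient {γ lam : ℝ} (hγ : 0 < γ) {z : ℝ} (hz : z ≤ 0) :
    ∃ s : ℝ, ∀ t ≤ 0,
      MCP γ lam z + z ^ 2 / (2 * γ) + s * (t - z) ≤ MCP γ lam t + t ^ 2 / (2 * γ) := by
  by_cases hzc : |z| ≤ γ * lam
  · refine ⟨-lam, fun t ht => ?_⟩
    simp only [MCP, hzc, if_true]
    rw [abs_of_nonpos hz, abs_of_nonpos ht]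
    split_ifs with htc
    · linarith
    · have h : γ * lam ^ 2 / 2 + t ^ 2 / (2 * γ) + lam * t = (t + γ * lam) ^ 2 / (2 * γ) := by
        field_simp
        ring
      have : 0 ≤ (t + γ * lam) ^ 2 / (2 * γ) := by positivity
      linarith
  · refine ⟨z / γ, fun t ht => ?_⟩
    simp only [MCP, hzc, if_false]
    rw [abs_of_nonpos hz] at hzc
    rw [abs_of_nonpos ht]
    split_ifs with htc
    · have h : -lam * t - (γ * lam ^ 2 / 2 + z ^ 2 / (2 * γ) + z / γ * (t - z)) =
          (-z - γ * lam) * (-z + γ * lam + 2 * t) / (2 * γ) := by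
        field_simp
        ring
      have : 0 ≤ (-z - γ * lam) * (-z + γ * lam + 2 * t) / (2 * γ) := by
        apply div_nonneg (mul_nonneg _ _) <;> linarith
      linarith
    · have h : t ^ 2 / (2 * γ) - z ^ 2 / (2 * γ) - z / γ * (t - z) =
          (t - z) ^ 2 / (2 * γ) := by
        field_simp
        ring
      have : 0 ≤ (t - z) ^ 2 / (2 * γ) := by positivity
      linarith

/-- for `x ≤ 0`, `x + d ≤ 0` and `α ∈ (0,1)`:
`−(α/(1−α))(MCP(x+d) − MCP(x+αd)) + MCP(x+αd) − MCP(x) ≤ α d² / (2γ)`. -/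
theorem MCP_linesearch_bound (γ lam : ℝ) (hγ : 0 < γ) (hlam : 0 ≤ lam)
    (x d : ℝ) (hx : x ≤ 0) (hxd : x + d ≤ 0) (α : ℝ) (hα0 : 0 < α) (hα1 : α < 1) :
    -(α / (1 - α)) * (MCP γ lam (x + d) - MCP γ lam (x + α * d)) +
        MCP γ lam (x + α * d) - MCP γ lam x ≤ α * d ^ 2 / (2 * γ) := by
  have hα : 0 < 1 - α := by linarith
  have hz : x + α * d ≤ 0 := by nlinarith
  obtain ⟨s, hs⟩ := MCP_add_sq_exists_subgradient (lam := lam) hγ hz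
  have h₀ := mul_le_mul_of_nonneg_left (hs x hx) hα.le
  have h₁ := mul_le_mul_of_nonneg_left (hs (x + d) hxd) hα0.le
  have key : MCP γ lam (x + α * d) - (1 - α) * MCP γ lam x - α * MCP γ lam (x + d) ≤
      (1 - α) * (α * d ^ 2 / (2 * γ)) := by
    have h : (1 - α) * (x ^ 2 / (2 * γ)) + α * ((x + d) ^ 2 / (2 * γ)) -
        (x + α * d) ^ 2 / (2 * γ) = (1 - α) * (α * d ^ 2 / (2 * γ)) := by
      field_simp
      ring
    linarith
  refine le_of_mul_le_mul_left (le_of_eq_of_le ?_ key) hα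
  field_simp
  ring
end

section
/- Let S be a real symmetric p×p matrix, L ∈ F with det(L + J) > 0, Q = (L + J)^{-1}, and let M be a p²×p² real positive semidefinite matrix. Define the quadratic model G(Δ) = Tr(Δ(S − Q)) + (1/2) vec(Δ)^T M vec(Δ) + ρ_MCP(L + Δ; λ) on symmetric Δ. If Δ* minimizes G over the (convex) set { Δ symmetric : L + Δ ∈ F }, then for every α ∈ (0,1): Tr(Δ*(S − Q)) ≤ −((1+α)/2)·vec(Δ*)^T M vec(Δ*) − (1/(1−α))·(ρ_MCP(L + Δ*; λ) − ρ_MCP(L + αΔ*; λ)). -/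
open Matrix BigOperators

/-- The MCP penalty of a matrix: the sum of `MCP` over all off-diagonal entries. -/
noncomputable def rhoMCP {p : ℕ} (γ lam : ℝ) (L : Matrix (Fin p) (Fin p) ℝ) : ℝ :=
  ∑ i, ∑ j ∈ Finset.univ.filter (fun j => j ≠ i), MCP γ lam (L i j)

/-- Column-stacking of a `p × p` matrix into a vector indexed by `Fin p × Fin p`. -/
def vecM {p : ℕ} (Δ : Matrix (Fin p) (Fin p) ℝ) : Fin p × Fin p → ℝ :=
  fun q => Δ q.1 q.2

theorem convex_setF (p : ℕ) : Convex ℝ (setF p) := by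
  rintro A ⟨hAs, hAn, hAr⟩ B ⟨hBs, hBn, hBr⟩ a b ha hb -
  refine ⟨(hAs.smul a).add (hBs.smul b), fun i j hij => ?_, fun i => ?_⟩
  · simpa using add_nonpos (mul_nonpos_of_nonneg_of_nonpos ha (hAn i j hij))
      (mul_nonpos_of_nonneg_of_nonpos hb (hBn i j hij))
  · simp [Finset.sum_add_distrib, ← Finset.mul_sum, hAr i, hBr i]

theorem vecM_smul {p : ℕ} (c : ℝ) (Δ : Matrix (Fin p) (Fin p) ℝ) :
    vecM (c • Δ) = c • vecM Δ := rfl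

/-- if `Δ*` minimizes the quadratic model
`G(Δ) = Tr(Δ(S − Q)) + (1/2) vec(Δ)ᵀ M vec(Δ) + ρ_MCP(L + Δ; λ)` over
`{ Δ symmetric : L + Δ ∈ F }`, then for every `α ∈ (0,1)`:
`Tr(Δ*(S − Q)) ≤ −((1+α)/2) vec(Δ*)ᵀ M vec(Δ*)
  − (1/(1−α))(ρ_MCP(L + Δ*) − ρ_MCP(L + αΔ*))`. -/
theorem quadratic_model_descent_bound (p : ℕ) (hp : 2 ≤ p) (γ lam : ℝ)
    (hγ : 0 < γ) (hlam : 0 ≤ lam) (S : Matrix (Fin p) (Fin p) ℝ) (hS : S.IsSymm)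
    (L : Matrix (Fin p) (Fin p) ℝ) (hLF : L ∈ setF p)
    (hLdet : 0 < (L + matJ p).det)
    (Q : Matrix (Fin p) (Fin p) ℝ) (hQ : Q = (L + matJ p)⁻¹)
    (M : Matrix (Fin p × Fin p) (Fin p × Fin p) ℝ) (hM : M.PosSemidef)
    (Δstar : Matrix (Fin p) (Fin p) ℝ) (hΔsymm : Δstar.IsSymm)
    (hΔfeas : L + Δstar ∈ setF p)
    (hmin : ∀ Δ : Matrix (Fin p) (Fin p) ℝ, Δ.IsSymm → L + Δ ∈ setF p →
      (Δstar * (S - Q)).trace + (1 / 2) * (vecM Δstar ⬝ᵥ M *ᵥ vecM Δstar) +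
          rhoMCP γ lam (L + Δstar) ≤
        (Δ * (S - Q)).trace + (1 / 2) * (vecM Δ ⬝ᵥ M *ᵥ vecM Δ) +
          rhoMCP γ lam (L + Δ))
    (α : ℝ) (hα0 : 0 < α) (hα1 : α < 1) :
    (Δstar * (S - Q)).trace ≤
      -((1 + α) / 2) * (vecM Δstar ⬝ᵥ M *ᵥ vecM Δstar) -
        (1 / (1 - α)) *
          (rhoMCP γ lam (L + Δstar) - rhoMCP γ lam (L + α • Δstar)) := by
  have hfeas : L + α • Δstar ∈ setF p := by
    have h := convex_setF p hLF hΔfeas (sub_nonneg.2 hα1.le) hα0.le (sub_add_cancel 1 α)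
    convert h using 1
    module
  have h := hmin (α • Δstar) (hΔsymm.smul α) hfeas
  rw [Matrix.smul_mul, trace_smul, vecM_smul, mulVec_smul, smul_dotProduct, dotProduct_smul] at h
  simp only [smul_eq_mul] at h
  have hα : 0 < 1 - α := sub_pos.2 hα1
  refine le_of_mul_le_mul_left ?_ hα
  rw [mul_sub (1 - α), ← mul_assoc (1 - α) (1 / (1 - α)), mul_one_div_cancel hα.ne']
  linarith
end

section
/- (Sufficient decrease, Lemma on decrease in objective) Let S be symmetric, L ∈ F with det(L + J) > 0, Q = (L + J)^{-1}, and let M be a p²×p² symmetric matrix with M ⪰ λ_min I where λ_min > 1/γ. Let Δ minimize the quadratic model G(Δ') = Tr(Δ'(S − Q)) + (1/2) vec(Δ')^T M vec(Δ') + ρ_MCP(L + Δ'; λ) over { Δ' symmetric : L + Δ' ∈ F }. Suppose θ > 0 is such that for every s ∈ [0,1] the matrix L + sΔ + J is invertible and the square of its inverse's spectral norm is at most θ (a bound on the Hessian of f along the segment). Then for every α ∈ (0,1): F(L + αΔ) − F(L) ≤ −(α/2)(λ_min − 1/γ − αθ)·‖Δ‖_F², where F(L) = Tr(L S) − log det(L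 + J) + ρ_MCP(L; λ). -/
open Matrix BigOperators

/-- The penalized negative log-likelihood objective
`F(L) = Tr(L S) − log det (L + J) + ρ_MCP(L; λ)`. -/
noncomputable def objF {p : ℕ} (γ lam : ℝ) (S L : Matrix (Fin p) (Fin p) ℝ) : ℝ :=
  (L * S).trace - Real.log (L + matJ p).det + rhoMCP γ lam L

lemma MCP_add_sq_eq {γ : ℝ} (hγ : 0 < γ) (lam x : ℝ) :
    MCP γ lam x + x ^ 2 / (2 * γ) = lam * |x| + (max (|x| - γ * lam) 0) ^ 2 / (2 * γ) := by
  unfold MCP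
  split_ifs with h
  · rw [max_eq_right (by linarith)]
    ring
  · rw [max_eq_left (by linarith), ← sq_abs x]
    field_simp
    ring

lemma convexOn_MCP_add_sq {γ lam : ℝ} (hγ : 0 < γ) (hlam : 0 ≤ lam) :
    ConvexOn ℝ Set.univ fun x => MCP γ lam x + x ^ 2 / (2 * γ) := by
  have habs : ConvexOn ℝ Set.univ fun x : ℝ => |x| := convexOn_univ_norm
  have hmax : ConvexOn ℝ Set.univ fun x : ℝ => max (|x| - γ * lam) 0 :=
    (habs.sub (concaveOn_const _ convex_univ)).sup (convexOn_const _ convex_univ)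
  have hsq := (hmax.pow (fun x _ => le_max_right _ _) 2).smul (c := (2 * γ)⁻¹) (by positivity)
  refine ((habs.smul hlam).add hsq).congr fun x _ => ?_
  simp only [Pi.add_apply, Pi.pow_apply, smul_eq_mul]
  rw [MCP_add_sq_eq hγ]
  ring

/-- `MCP` is weakly convex with modulus `1 / γ`. -/
lemma MCP_add_mul_le {γ lam : ℝ} (hγ : 0 < γ) (hlam : 0 ≤ lam) (x d : ℝ) {t : ℝ}
    (ht0 : 0 ≤ t) (ht1 : t ≤ 1) :
    MCP γ lam (x + t * d) ≤
      (1 - t) * MCP γ lam x + t * MCP γ lam (x + d) + t * (1 - t) / (2 * γ) * d ^ 2 := by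
  have h := (convexOn_MCP_add_sq hγ hlam).2 (Set.mem_univ x) (Set.mem_univ (x + d))
    (sub_nonneg.2 ht1) ht0 (by ring)
  simp only [smul_eq_mul] at h
  rw [show (1 - t) * x + t * (x + d) = x + t * d by ring] at h
  have e : (1 - t) * (x ^ 2 / (2 * γ)) + t * ((x + d) ^ 2 / (2 * γ)) - (x + t * d) ^ 2 / (2 * γ)
      = t * (1 - t) / (2 * γ) * d ^ 2 := by
    field_simp
    ring
  linarith

lemma rhoMCP_add_smul_le {p : ℕ} {γ lam : ℝ} (hγ : 0 < γ) (hlam : 0 ≤ lam)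
    (L Δ : Matrix (Fin p) (Fin p) ℝ) {t : ℝ} (ht0 : 0 ≤ t) (ht1 : t ≤ 1) :
    rhoMCP γ lam (L + t • Δ) ≤ (1 - t) * rhoMCP γ lam L + t * rhoMCP γ lam (L + Δ) +
      t * (1 - t) / (2 * γ) * ∑ i, ∑ j, Δ i j ^ 2 := by
  unfold rhoMCP
  simp only [Finset.mul_sum, ← Finset.sum_add_distrib]
  refine Finset.sum_le_sum fun i _ => ?_
  have hc : 0 ≤ t * (1 - t) / (2 * γ) :=
    div_nonneg (mul_nonneg ht0 (sub_nonneg.2 ht1)) (by positivity)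
  calc _ ≤ ∑ j with j ≠ i, ((1 - t) * MCP γ lam (L i j) + t * MCP γ lam ((L + Δ) i j) +
          t * (1 - t) / (2 * γ) * Δ i j ^ 2) :=
        Finset.sum_le_sum fun j _ => MCP_add_mul_le hγ hlam (L i j) (Δ i j) ht0 ht1
    _ ≤ _ := by
        rw [Finset.sum_add_distrib, Finset.sum_add_distrib]
        gcongr
        exact Finset.subset_univ _

lemma setF_add_smul_mem {p : ℕ} {L Δ : Matrix (Fin p) (Fin p) ℝ} (hL : L ∈ setF p)
    (hΔ : L + Δ ∈ setF p) {t : ℝ} (ht0 : 0 ≤ t) (ht1 : t ≤ 1) : L + t • Δ ∈ setF p := by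
  have e : L + t • Δ = (1 - t) • L + t • (L + Δ) := by
    rw [smul_add, sub_smul, one_smul]
    abel
  rw [e]
  refine ⟨(hL.1.smul _).add (hΔ.1.smul _), fun i j hij => ?_, fun i => ?_⟩
  · have h1 := mul_nonpos_of_nonneg_of_nonpos (sub_nonneg.2 ht1) (hL.2.1 i j hij)
    have h2 := mul_nonpos_of_nonneg_of_nonpos ht0 (hΔ.2.1 i j hij)
    simpa only [Matrix.add_apply, Matrix.smul_apply, smul_eq_mul] using add_nonpos h1 h2
  · have h1 := hL.2.2 i
    have h2 := hΔ.2.2 i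
    simp only [Matrix.add_apply (_ • _), Matrix.smul_apply, smul_eq_mul, Finset.sum_add_distrib,
      ← Finset.mul_sum] at h1 h2 ⊢
    rw [h1, h2]
    ring

lemma mul_sum_sq_le_vecM_dotProduct {p : ℕ} {M : Matrix (Fin p × Fin p) (Fin p × Fin p) ℝ}
    {c : ℝ} (hM : (M - c • (1 : Matrix (Fin p × Fin p) (Fin p × Fin p) ℝ)).PosSemidef)
    (Δ : Matrix (Fin p) (Fin p) ℝ) :
    c * ∑ i, ∑ j, Δ i j ^ 2 ≤ vecM Δ ⬝ᵥ M *ᵥ vecM Δ := by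
  have h := hM.dotProduct_mulVec_nonneg (vecM Δ)
  have e : vecM Δ ⬝ᵥ vecM Δ = ∑ i, ∑ j, Δ i j ^ 2 := by
    simp only [dotProduct, vecM, Fintype.sum_prod_type, sq]
  rw [star_trivial, Matrix.sub_mulVec, Matrix.smul_mulVec, Matrix.one_mulVec, dotProduct_sub,
    dotProduct_smul, e, smul_eq_mul] at h
  linarith

lemma hasDerivAt_log_det_add_smul {n : Type*} [Fintype n] [DecidableEq n] (A D : Matrix n n ℝ)
    {s : ℝ} (h : (A + s • D).det ≠ 0) :
    HasDerivAt (fun t : ℝ => Real.log (A + t • D).det) ((A + s • D)⁻¹ * D).trace s := by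
  set B := A + s • D with hB
  have hu : IsUnit B.det := isUnit_iff_ne_zero.2 h
  have e : (fun t : ℝ => (A + t • D).det) = fun t => B.det * (1 + (t - s) • (B⁻¹ * D)).det := by
    funext t
    rw [← Matrix.det_mul, mul_add, mul_one, Matrix.mul_smul, Matrix.mul_nonsing_inv_cancel_left _ _ hu,
      hB, sub_smul]
    congr 1
    abel
  have hd : HasDerivAt (fun t : ℝ => (A + t • D).det) (B.det * (B⁻¹ * D).trace) s := by
    rw [e]
    refine HasDerivAt.const_mul _ ?_
    rw [funext fun t : ℝ => Matrix.det_one_add_smul (t - s) (B⁻¹ * D)]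
    set q := (Matrix.det (1 + (Polynomial.X : Polynomial ℝ) •
      (B⁻¹ * D).map Polynomial.C)).divX.divX
    have hs : HasDerivAt (fun t : ℝ => t - s) 1 s := (hasDerivAt_id s).sub_const s
    have hev : HasDerivAt (fun t : ℝ => q.eval (t - s)) (q.derivative.eval (s - s) * 1) s :=
      HasDerivAt.comp (h := fun t => t - s) s (q.hasDerivAt (s - s)) hs
    refine (((hs.const_mul (B⁻¹ * D).trace).const_add 1).add
      (hev.mul (hs.pow 2))).congr_deriv ?_
    simp
  exact (hd.log h).congr_deriv (mul_div_cancel_left₀ _ h)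

lemma trace_mul_le_of_sum_sq_le {n : Type*} [Fintype n] {X Y : Matrix n n ℝ} {c : ℝ}
    (hX : ∑ i, ∑ j, X i j ^ 2 ≤ c) (hY : ∑ i, ∑ j, Y i j ^ 2 ≤ c) : (X * Y).trace ≤ c := by
  have h : (X * Y).trace ≤ (∑ i, ∑ j, X i j ^ 2 + ∑ i, ∑ j, Y i j ^ 2) / 2 := by
    rw [Finset.sum_comm (f := fun i j => Y i j ^ 2), ← Finset.sum_add_distrib, Finset.sum_div]
    simp only [Matrix.trace, Matrix.diag, Matrix.mul_apply]
    refine Finset.sum_le_sum fun i _ => ?_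
    rw [← Finset.sum_add_distrib, Finset.sum_div]
    refine Finset.sum_le_sum fun j _ => ?_
    linarith [two_mul_le_add_sq (X i j) (Y j i)]
  linarith

lemma sum_sq_mul_le {n : Type*} [Fintype n] {B D : Matrix n n ℝ} {θ : ℝ}
    (hB : ∀ v : n → ℝ, ∑ i, (B *ᵥ v) i ^ 2 ≤ θ * ∑ i, v i ^ 2) :
    ∑ i, ∑ j, (B * D) i j ^ 2 ≤ θ * ∑ i, ∑ j, D i j ^ 2 := by
  rw [Finset.sum_comm, Finset.sum_comm (f := fun i j => D i j ^ 2), Finset.mul_sum]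
  exact Finset.sum_le_sum fun j _ => hB fun i => D i j

/-- Descent inequality for `-log det` along a segment on which the inverse is bounded. -/
lemma neg_log_det_add_smul_le {n : Type*} [Fintype n] [DecidableEq n] (A D : Matrix n n ℝ) {θ : ℝ}
    (h : ∀ s : ℝ, 0 ≤ s → s ≤ 1 → (A + s • D).det ≠ 0 ∧
      ∀ v : n → ℝ, ∑ i, ((A + s • D)⁻¹ *ᵥ v) i ^ 2 ≤ θ * ∑ i, v i ^ 2)
    {α : ℝ} (hα0 : 0 ≤ α) (hα1 : α ≤ 1) :
    -Real.log (A + α • D).det ≤ -Real.log A.det - α * (A⁻¹ * D).trace +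
      α ^ 2 / 2 * (θ * ∑ i, ∑ j, D i j ^ 2) := by
  set N := θ * ∑ i, ∑ j, D i j ^ 2
  let g : ℝ → ℝ := fun s =>
    -Real.log (A + s • D).det + s * (A⁻¹ * D).trace - s ^ 2 / 2 * N
  have hA := h 0 le_rfl zero_le_one
  rw [zero_smul, add_zero] at hA
  have hg : ∀ s ∈ Set.Icc (0 : ℝ) 1,
      HasDerivAt g (-((A + s • D)⁻¹ * D).trace + (A⁻¹ * D).trace - s * N) s := by
    intro s hs
    have h1 := (hasDerivAt_log_det_add_smul A D (h s hs.1 hs.2).1).neg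
    have h2 := (hasDerivAt_id s).mul_const (A⁻¹ * D).trace
    have h3 := (((hasDerivAt_id s).pow 2).div_const 2).mul_const N
    refine ((h1.add h2).sub h3).congr_deriv ?_
    simp
  have hle : ∀ s ∈ Set.Icc (0 : ℝ) 1,
      -((A + s • D)⁻¹ * D).trace + (A⁻¹ * D).trace - s * N ≤ 0 := by
    intro s hs
    obtain ⟨hdet, hbd⟩ := h s hs.1 hs.2
    have hres : A⁻¹ - (A + s • D)⁻¹ = s • ((A + s • D)⁻¹ * D * A⁻¹) := by
      have h1 := Matrix.mul_nonsing_inv A (isUnit_iff_ne_zero.2 hA.1)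
      have h2 := Matrix.nonsing_inv_mul (A + s • D) (isUnit_iff_ne_zero.2 hdet)
      calc A⁻¹ - (A + s • D)⁻¹ = (A + s • D)⁻¹ * (A + s • D) * A⁻¹ - (A + s • D)⁻¹ * (A * A⁻¹) := by
            rw [h1, h2, one_mul, mul_one]
        _ = s • ((A + s • D)⁻¹ * D * A⁻¹) := by
            rw [mul_add, add_mul, mul_assoc _ A, add_sub_cancel_left, Matrix.mul_smul,
              Matrix.smul_mul]
    have htr : -((A + s • D)⁻¹ * D).trace + (A⁻¹ * D).trace =
        s * ((A + s • D)⁻¹ * D * (A⁻¹ * D)).trace := by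
      rw [neg_add_eq_sub, ← Matrix.trace_sub, ← Matrix.sub_mul, hres, Matrix.smul_mul,
        Matrix.trace_smul, smul_eq_mul, mul_assoc _ A⁻¹]
    have := mul_le_mul_of_nonneg_left
      (trace_mul_le_of_sum_sq_le (sum_sq_mul_le (D := D) hbd) (sum_sq_mul_le (D := D) hA.2)) hs.1
    linarith
  have hanti : AntitoneOn g (Set.Icc 0 1) := by
    refine antitoneOn_of_deriv_nonpos (convex_Icc 0 1)
      (fun s hs => (hg s hs).continuousAt.continuousWithinAt)
      (fun s hs => (hg s (interior_subset hs)).differentiableAt.differentiableWithinAt)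
      fun s hs => ?_
    rw [(hg s (interior_subset hs)).deriv]
    exact hle s (interior_subset hs)
  have := hanti (Set.left_mem_Icc.2 zero_le_one) ⟨hα0, hα1⟩ hα0
  simp only [g, zero_smul, add_zero] at this
  linarith

/-- First-order consequence of minimality of a quadratic-plus-weakly-convex model. -/
lemma add_le_of_forall_mul_le {a m c d : ℝ}
    (h : ∀ t : ℝ, 0 < t → t < 1 →
      a + 1 / 2 * m + d ≤ t * a + 1 / 2 * (t ^ 2 * m) + t * d + t * (1 - t) * c) :
    a + d ≤ -m + c := by
  have h' : ∀ t ∈ Set.Ioo (0 : ℝ) 1, a + d + (1 + t) / 2 * m - t * c ≤ 0 := by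
    intro t ht
    have := h t ht.1 ht.2
    have h1 : 0 < 1 - t := sub_pos.2 ht.2
    refine nonpos_of_mul_nonpos_right (a := 1 - t) ?_ h1
    linarith
  have hc : Continuous fun t : ℝ => a + d + (1 + t) / 2 * m - t * c := by fun_prop
  have := le_of_tendsto ((hc.tendsto 1).mono_left (nhdsWithin_le_nhds (s := Set.Iio 1)))
    (Filter.eventually_of_mem (Ioo_mem_nhdsLT zero_lt_one) h')
  linarith

/-- sufficient decrease: if `Δ` minimizes the quadratic model with
Hessian approximation `M ⪰ λmin I`, `λmin > 1/γ`, and the Hessian of the smooth part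
is bounded by `θ` along the segment (the squared spectral norm of `(L + sΔ + J)⁻¹`
is at most `θ` for `s ∈ [0,1]`), then for every `α ∈ (0,1)`:
`F(L + αΔ) − F(L) ≤ −(α/2)(λmin − 1/γ − αθ) ‖Δ‖_F²`. -/
theorem sufficient_decrease (p : ℕ) (hp : 2 ≤ p) (γ lam : ℝ)
    (hγ : 0 < γ) (hlam : 0 ≤ lam) (S : Matrix (Fin p) (Fin p) ℝ) (hS : S.IsSymm)
    (L : Matrix (Fin p) (Fin p) ℝ) (hLF : L ∈ setF p)
    (hLdet : 0 < (L + matJ p).det)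
    (Q : Matrix (Fin p) (Fin p) ℝ) (hQ : Q = (L + matJ p)⁻¹)
    (M : Matrix (Fin p × Fin p) (Fin p × Fin p) ℝ) (hMsymm : M.IsSymm)
    (lammin : ℝ) (hlammin : 1 / γ < lammin)
    (hMlower : (M - lammin • (1 : Matrix (Fin p × Fin p) (Fin p × Fin p) ℝ)).PosSemidef)
    (Δ : Matrix (Fin p) (Fin p) ℝ) (hΔsymm : Δ.IsSymm) (hΔfeas : L + Δ ∈ setF p)
    (hmin : ∀ Δ' : Matrix (Fin p) (Fin p) ℝ, Δ'.IsSymm → L + Δ' ∈ setF p →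
      (Δ * (S - Q)).trace + (1 / 2) * (vecM Δ ⬝ᵥ M *ᵥ vecM Δ) +
          rhoMCP γ lam (L + Δ) ≤
        (Δ' * (S - Q)).trace + (1 / 2) * (vecM Δ' ⬝ᵥ M *ᵥ vecM Δ') +
          rhoMCP γ lam (L + Δ'))
    (θ : ℝ) (hθ : 0 < θ)
    (hHess : ∀ s : ℝ, 0 ≤ s → s ≤ 1 →
      (L + s • Δ + matJ p).det ≠ 0 ∧
        ∀ v : Fin p → ℝ,
          ∑ i, ((L + s • Δ + matJ p)⁻¹ *ᵥ v) i ^ 2 ≤ θ * ∑ i, v i ^ 2)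
    (α : ℝ) (hα0 : 0 < α) (hα1 : α < 1) :
    objF γ lam S (L + α • Δ) - objF γ lam S L ≤
      -(α / 2) * (lammin - 1 / γ - α * θ) * ∑ i, ∑ j, Δ i j ^ 2 := by
  subst hQ
  set N := ∑ i, ∑ j, Δ i j ^ 2 with hN
  have hN0 : 0 ≤ N := Finset.sum_nonneg fun i _ => Finset.sum_nonneg fun j _ => sq_nonneg _
  have hm := mul_sum_sq_le_vecM_dotProduct hMlower Δ
  have hdir : (Δ * (S - (L + matJ p)⁻¹)).trace + (rhoMCP γ lam (L + Δ) - rhoMCP γ lam L) ≤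
      -(vecM Δ ⬝ᵥ M *ᵥ vecM Δ) + 1 / (2 * γ) * N := by
    refine add_le_of_forall_mul_le fun t ht0 ht1 => ?_
    have h1 := hmin (t • Δ) (hΔsymm.smul t) (setF_add_smul_mem hLF hΔfeas ht0.le ht1.le)
    have h2 := rhoMCP_add_smul_le hγ hlam L Δ ht0.le ht1.le
    have h3 : vecM (t • Δ) = t • vecM Δ := rfl
    rw [h3, Matrix.smul_mul, Matrix.trace_smul, Matrix.mulVec_smul, dotProduct_smul,
      smul_dotProduct] at h1
    simp only [smul_eq_mul] at h1
    have h4 : t * (1 - t) / (2 * γ) * N = t * (1 - t) * (1 / (2 * γ) * N) := by ring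
    linarith
  have hlog := neg_log_det_add_smul_le (L + matJ p) Δ (θ := θ)
    (fun s hs0 hs1 => by simpa only [add_right_comm] using hHess s hs0 hs1) hα0.le hα1.le
  have hrho := rhoMCP_add_smul_le hγ hlam L Δ hα0.le hα1.le
  have htr : ((L + matJ p)⁻¹ * Δ).trace = (Δ * S).trace - (Δ * (S - (L + matJ p)⁻¹)).trace := by
    rw [Matrix.mul_sub, Matrix.trace_sub, Matrix.trace_mul_comm _ Δ]
    ring
  have hobj : ((L + α • Δ) * S).trace = (L * S).trace + α * (Δ * S).trace := by
    rw [Matrix.add_mul, Matrix.trace_add, Matrix.smul_mul, Matrix.trace_smul, smul_eq_mul]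
  unfold objF
  rw [hobj, add_right_comm L]
  rw [htr] at hlog
  have e1 : α * (1 - α) / (2 * γ) * N = α * (1 - α) / 2 * (1 / γ * N) := by ring
  have e2 : 1 / (2 * γ) * N = 1 / 2 * (1 / γ * N) := by ring
  rw [e2] at hdir
  rw [← hN, e1] at hrho
  have hdir' := mul_le_mul_of_nonneg_left hdir hα0.le
  have hm' := mul_le_mul_of_nonneg_left hm hα0.le
  have hk := mul_nonneg hα0.le (mul_nonneg (sub_nonneg.2 hlammin.le) hN0)
  have hk2 : 0 ≤ α ^ 2 * (1 / γ * N) := by positivity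
  linarith
end
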